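/- arXiv:2311.02537 — 7 statements merged into one kernel-verified Lean document; each statement's English description precedes it below -/
import Mathlib

section
/- Assume max_i (R_i − c_i) > κ_S (Assumption 2). Then there exists a unique γ_1 ∈ (0,1) with u_h(γ_1) = κ_S. Moreover, for every γ ∈ [0, γ_1) and every β ∈ [0,1], no safe action is implementable by (γ, β), while for every γ ∈ [γ_1, 1] the contract (γ, 1) implements some safe action. -/
/-- The upper envelope function `u_h(γ) = max_j (γ R_j - c_j)`. -/
noncomputable def uh (n : ℕ) (hn : 0 < n) (R c : Fin n → ℝ) (γ : ℝ) : ℝ :=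
  Finset.univ.sup' (Finset.univ_nonempty_iff.mpr (Fin.pos_iff_nonempty.mp hn))
    (fun j => γ * R j - c j)

/-- The safe action `i` is implementable by the linear contract `(γ, β)`:
(IC-safe), (IC-unsafe) and (IR). -/
def Implementable (n : ℕ) (R c : Fin n → ℝ) (κS α γ β : ℝ) (i : Fin n) : Prop :=
  (∀ j, γ * R i - c i ≥ γ * R j - c j) ∧
  (∀ j, γ * R i - c i - κS ≥ (1 - β) * (1 - α) * γ * R j - c j) ∧
  γ * R i - c i - κS ≥ 0

theorem le_uh (n : ℕ) (hn : 0 < n) (R c : Fin n → ℝ) (γ : ℝ) (j : Fin n) :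
    γ * R j - c j ≤ uh n hn R c γ :=
  Finset.le_sup' (fun j => γ * R j - c j) (Finset.mem_univ j)

theorem exists_uh_eq (n : ℕ) (hn : 0 < n) (R c : Fin n → ℝ) (γ : ℝ) :
    ∃ i, uh n hn R c γ = γ * R i - c i := by
  obtain ⟨i, -, hi⟩ := Finset.exists_mem_eq_sup'
    (Finset.univ_nonempty_iff.mpr (Fin.pos_iff_nonempty.mp hn)) (fun j => γ * R j - c j)
  exact ⟨i, hi⟩

theorem uh_continuous (n : ℕ) (hn : 0 < n) (R c : Fin n → ℝ) :
    Continuous (uh n hn R c) := by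
  unfold uh
  exact Continuous.finset_sup'_apply _ fun j _ => by fun_prop

theorem uh_strictMono (n : ℕ) (hn : 0 < n) (R c : Fin n → ℝ) (hR : ∀ j, 0 < R j) :
    StrictMono (uh n hn R c) := by
  intro x y hxy
  obtain ⟨i, hi⟩ := exists_uh_eq n hn R c x
  calc uh n hn R c x = x * R i - c i := hi
    _ < y * R i - c i := sub_lt_sub_right (mul_lt_mul_of_pos_right hxy (hR i)) _
    _ ≤ uh n hn R c y := le_uh n hn R c y i

theorem uh_zero_nonpos (n : ℕ) (hn : 0 < n) (R c : Fin n → ℝ) (hc : ∀ j, 0 ≤ c j) :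
    uh n hn R c 0 ≤ 0 := by
  obtain ⟨i, hi⟩ := exists_uh_eq n hn R c 0
  linarith [hc i]

/-- under Assumption 2 (`max_i (R_i - c_i) > κ_S`) there is a
unique `γ₁ ∈ (0,1)` with `u_h(γ₁) = κ_S`; below `γ₁` no safe action is
implementable, and for `γ ∈ [γ₁, 1]` the contract `(γ, 1)` implements some
safe action. -/
theorem threshold_gamma_one
    (n : ℕ) (hn : 0 < n) (R c : Fin n → ℝ)
    (hc0 : 0 ≤ c ⟨0, hn⟩) (hc : StrictMono c)
    (hR0 : 0 < R ⟨0, hn⟩) (hR : StrictMono R)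
    (κS : ℝ) (hκS : 0 < κS) (α : ℝ) (hα0 : 0 < α) (hα1 : α < 1)
    (hA2 : ∃ i, R i - c i > κS) :
    ∃ γ₁ ∈ Set.Ioo (0 : ℝ) 1,
      uh n hn R c γ₁ = κS ∧
      (∀ γ ∈ Set.Ioo (0 : ℝ) 1, uh n hn R c γ = κS → γ = γ₁) ∧
      (∀ γ ∈ Set.Ico (0 : ℝ) γ₁, ∀ β ∈ Set.Icc (0 : ℝ) 1, ∀ i : Fin n,
        ¬ Implementable n R c κS α γ β i) ∧
      (∀ γ ∈ Set.Icc γ₁ 1, ∃ i : Fin n, Implementable n R c κS α γ 1 i) := by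
  have first_le (j : Fin n) : (⟨0, hn⟩ : Fin n) ≤ j := Nat.zero_le j
  have c_nonneg (j : Fin n) : 0 ≤ c j := hc0.trans (hc.monotone (first_le j))
  have R_pos (j : Fin n) : 0 < R j := hR0.trans_le (hR.monotone (first_le j))
  have u_mono := uh_strictMono n hn R c R_pos
  have u_zero : uh n hn R c 0 < κS := (uh_zero_nonpos n hn R c c_nonneg).trans_lt hκS
  have u_one : κS < uh n hn R c 1 := by
    obtain ⟨i, hi⟩ := hA2
    linarith [le_uh n hn R c 1 i]
  obtain ⟨γ₁, hγ₁, u_γ₁⟩ := intermediate_value_Ioo zero_le_one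
    (uh_continuous n hn R c).continuousOn ⟨u_zero, u_one⟩
  refine ⟨γ₁, hγ₁, u_γ₁, fun γ _ hγ => u_mono.injective (hγ.trans u_γ₁.symm), ?_, ?_⟩
  · rintro γ ⟨-, hγ⟩ β - i ⟨-, -, ir⟩
    linarith [u_mono hγ, le_uh n hn R c γ i]
  · rintro γ ⟨hγ, -⟩
    obtain ⟨i, hi⟩ := exists_uh_eq n hn R c γ
    have ir : κS ≤ γ * R i - c i := hi ▸ u_γ₁ ▸ u_mono.monotone hγ
    refine ⟨i, fun j => hi ▸ le_uh n hn R c γ j, fun j => ?_, by linarith⟩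
    rw [sub_self, zero_mul, zero_mul, zero_mul]
    linarith [c_nonneg j]
end

section
/- For every γ ∈ (0,1] with u_h(γ) ≥ κ_S, the threshold β(γ) lies in [0,1], and for every β ∈ [0,1]: some safe action is implementable by the contract (γ, β) if and only if β ≥ β(γ). -/
/-- The inspection threshold `β(γ) = max{1 - δ(γ)/(γ(1-α)), 0}`, where
`δ(γ)` is the unique value in `[0,γ]` with `u_h(δ(γ)) = u_h(γ) - κ_S`. -/
noncomputable def betaFn (α : ℝ) (δ : ℝ → ℝ) (γ : ℝ) : ℝ :=
  max (1 - δ γ / (γ * (1 - α))) 0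

theorem uh_le_iff (n : ℕ) (hn : 0 < n) (R c : Fin n → ℝ) (γ a : ℝ) :
    uh n hn R c γ ≤ a ↔ ∀ j, γ * R j - c j ≤ a := by
  simp [uh]

/-- Some safe action is implementable iff the envelope, net of the safety cost, is nonnegative and
dominates the envelope at the share that an unsafe agent effectively receives. -/
theorem exists_implementable_iff (n : ℕ) (hn : 0 < n) (R c : Fin n → ℝ) (κS α γ β : ℝ) :
    (∃ i, Implementable n R c κS α γ β i) ↔
      uh n hn R c ((1 - β) * (1 - α) * γ) ≤ uh n hn R c γ - κS ∧ κS ≤ uh n hn R c γ := by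
  constructor
  · rintro ⟨i, safe, unsf, ir⟩
    have hi := (uh_le_iff n hn R c γ _).1 le_rfl i
    exact ⟨(uh_le_iff n hn R c _ _).2 fun j => by linarith [unsf j], by linarith⟩
  · rintro ⟨h, hκ⟩
    obtain ⟨i, hi⟩ := exists_uh_eq n hn R c γ
    refine ⟨i, fun j => ?_, fun j => ?_, by linarith⟩
    · exact hi ▸ (uh_le_iff n hn R c γ _).1 le_rfl j
    · exact hi ▸ (uh_le_iff n hn R c _ _).1 h j

/-- for every `γ ∈ (0,1]` with `u_h(γ) ≥ κ_S`, the threshold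
`β(γ)` lies in `[0,1]`, and for every `β ∈ [0,1]` some safe action is
implementable by `(γ, β)` iff `β ≥ β(γ)`. -/
theorem betaFn_threshold
    (n : ℕ) (hn : 0 < n) (R c : Fin n → ℝ)
    (hc0 : 0 ≤ c ⟨0, hn⟩) (hc : StrictMono c)
    (hR0 : 0 < R ⟨0, hn⟩) (hR : StrictMono R)
    (κS : ℝ) (hκS : 0 < κS) (α : ℝ) (hα0 : 0 < α) (hα1 : α < 1)
    (δ : ℝ → ℝ)
    (hδ : ∀ γ ∈ Set.Ioc (0 : ℝ) 1, κS ≤ uh n hn R c γ →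
      δ γ ∈ Set.Icc 0 γ ∧ uh n hn R c (δ γ) = uh n hn R c γ - κS) :
    ∀ γ ∈ Set.Ioc (0 : ℝ) 1, κS ≤ uh n hn R c γ →
      betaFn α δ γ ∈ Set.Icc (0 : ℝ) 1 ∧
      ∀ β ∈ Set.Icc (0 : ℝ) 1,
        ((∃ i : Fin n, Implementable n R c κS α γ β i) ↔ betaFn α δ γ ≤ β) := by
  intro γ hγ hκ
  obtain ⟨⟨hδ0, -⟩, hδu⟩ := hδ γ hγ hκ
  have hpos : 0 < γ * (1 - α) := mul_pos hγ.1 (by linarith)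
  refine ⟨⟨le_max_right _ _, max_le ?_ zero_le_one⟩, fun β hβ => ?_⟩
  · linarith [div_nonneg hδ0 hpos.le]
  have hRpos : ∀ j, 0 < R j := fun j => hR0.trans_le (hR.monotone (Nat.zero_le j.val))
  rw [exists_implementable_iff n hn, and_iff_left hκ, ← hδu,
    (uh_strictMono n hn R c hRpos).le_iff_le, betaFn, max_le_iff, and_iff_left hβ.1,
    sub_le_comm, le_div_iff₀ hpos, mul_assoc, mul_comm (1 - α)]
end

section
/- Let 0 < γ < γ' ≤ 1 with u_h(γ) ≥ κ_S (hence also u_h(γ') ≥ κ_S). Then δ(γ)/γ < δ(γ')/γ'. Consequently β(γ) ≥ β(γ'), and if β(γ) > 0 then β(γ) > β(γ'); that is, the inspection threshold β(·) is decreasing, and strictly decreasing wherever it is positive. -/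
theorem uh_convexOn (n : ℕ) (hn : 0 < n) (R c : Fin n → ℝ) :
    ConvexOn ℝ Set.univ (uh n hn R c) := by
  refine ⟨convex_univ, fun x _ y _ a b ha hb hab => ?_⟩
  refine Finset.sup'_le _ _ fun j _ => ?_
  have hx : x * R j - c j ≤ uh n hn R c x :=
    Finset.le_sup' (fun j => x * R j - c j) (Finset.mem_univ j)
  have hy : y * R j - c j ≤ uh n hn R c y :=
    Finset.le_sup' (fun j => y * R j - c j) (Finset.mem_univ j)
  simp only [smul_eq_mul]
  calc (a * x + b * y) * R j - c j
      = a * (x * R j - c j) + b * (y * R j - c j) := by linear_combination c j * hab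
    _ ≤ a * uh n hn R c x + b * uh n hn R c y := by gcongr

theorem uh_monotone (n : ℕ) (hn : 0 < n) (R c : Fin n → ℝ) (hR : ∀ j, 0 ≤ R j) :
    Monotone (uh n hn R c) := by
  intro x y hxy
  refine Finset.sup'_mono_fun fun j _ => ?_
  have := mul_le_mul_of_nonneg_right hxy (hR j)
  linarith

/-- If `f` is convex and `f x - f (t * x)` is positive, then scaling `x` up strictly increases it. -/
theorem ConvexOn.sub_lt_sub_of_scale {f : ℝ → ℝ} (hf : ConvexOn ℝ Set.univ f) {t x y : ℝ}
    (ht0 : 0 ≤ t) (ht1 : t < 1) (hx : 0 < x) (hxy : x < y) (hpos : 0 < f x - f (t * x)) :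
    f x - f (t * x) < f y - f (t * y) := by
  have htx : t * x < x := by nlinarith
  have hty : t * y < y := by nlinarith
  have htxy : t * x ≤ t * y := by gcongr
  have h₁ := hf.secant_mono (Set.mem_univ (t * x)) (Set.mem_univ x) (Set.mem_univ y)
    htx.ne' (htx.trans hxy).ne' hxy.le
  have h₂ := hf.secant_mono (Set.mem_univ y) (Set.mem_univ (t * x)) (Set.mem_univ (t * y))
    (htx.trans hxy).ne hty.ne htxy
  rw [← neg_div_neg_eq, neg_sub, neg_sub, ← neg_div_neg_eq (f (t * y) - f y), neg_sub,
    neg_sub] at h₂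
  have h := h₁.trans h₂
  have hlt : x - t * x < y - t * y := by nlinarith
  rw [div_le_div_iff₀ (by linarith) (by linarith)] at h
  by_contra! hle
  nlinarith [mul_lt_mul_of_pos_left hlt hpos,
    mul_le_mul_of_nonneg_right hle (sub_pos.mpr htx).le]

/-- for `0 < γ < γ' ≤ 1` with `u_h(γ) ≥ κ_S` (hence also
`u_h(γ') ≥ κ_S`), we have `δ(γ)/γ < δ(γ')/γ'`; consequently
`β(γ) ≥ β(γ')`, and strictly so whenever `β(γ) > 0`. -/
theorem betaFn_decreasing
    (n : ℕ) (hn : 0 < n) (R c : Fin n → ℝ)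
    (hc0 : 0 ≤ c ⟨0, hn⟩) (hc : StrictMono c)
    (hR0 : 0 < R ⟨0, hn⟩) (hR : StrictMono R)
    (κS : ℝ) (hκS : 0 < κS) (α : ℝ) (hα0 : 0 < α) (hα1 : α < 1)
    (δ : ℝ → ℝ)
    (hδ : ∀ γ ∈ Set.Ioc (0 : ℝ) 1, κS ≤ uh n hn R c γ →
      δ γ ∈ Set.Icc 0 γ ∧ uh n hn R c (δ γ) = uh n hn R c γ - κS)
    (γ γ' : ℝ) (hγ0 : 0 < γ) (hγγ' : γ < γ') (hγ'1 : γ' ≤ 1)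
    (hκ : κS ≤ uh n hn R c γ) :
    δ γ / γ < δ γ' / γ' ∧
    betaFn α δ γ' ≤ betaFn α δ γ ∧
    (0 < betaFn α δ γ → betaFn α δ γ' < betaFn α δ γ) := by
  have hR' : ∀ j, 0 ≤ R j := fun j => hR0.le.trans (hR.monotone (Nat.zero_le j.val))
  have hmono := uh_monotone n hn R c hR'
  have hγ'0 := hγ0.trans hγγ'
  obtain ⟨⟨hd0, hdγ⟩, hd⟩ := hδ γ ⟨hγ0, hγγ'.le.trans hγ'1⟩ hκ
  obtain ⟨-, hd'⟩ := hδ γ' ⟨hγ'0, hγ'1⟩ (hκ.trans (hmono hγγ'.le))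
  have hdlt : δ γ < γ := by
    refine lt_of_le_of_ne hdγ fun h => ?_
    rw [h] at hd
    linarith
  have hratio : δ γ / γ < δ γ' / γ' := by
    have hscale : δ γ / γ * γ = δ γ := div_mul_cancel₀ _ hγ0.ne'
    have hgap := (uh_convexOn n hn R c).sub_lt_sub_of_scale (t := δ γ / γ)
      (div_nonneg hd0 hγ0.le) ((div_lt_one hγ0).mpr hdlt) hγ0 hγγ' (by rw [hscale]; linarith)
    rw [hscale] at hgap
    by_contra! hle
    have := hmono ((div_le_iff₀ hγ'0).mp hle)
    linarith
  have hlt : 1 - δ γ' / (γ' * (1 - α)) < 1 - δ γ / (γ * (1 - α)) := by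
    rw [← div_div, ← div_div]
    have := div_lt_div_of_pos_right hratio (sub_pos.mpr hα1)
    linarith
  refine ⟨hratio, max_le_max_right 0 hlt.le, fun hpos => ?_⟩
  exact max_lt (lt_max_of_lt_left hlt) hpos
end

section
/- Let [a,b] ⊆ (0,1] with a < b and u_h(γ) ≥ κ_S for all γ ∈ [a,b], and suppose there are indices p and q such that u_h(γ) = γR_p − c_p and u_h(δ(γ)) = δ(γ)R_q − c_q for all γ ∈ [a,b]. Then the function f(γ) := δ(γ)/(γ(1−α)) is differentiable on (a,b) with derivative f'(γ) = (c_p − c_q + κ_S)/(R_q · γ² · (1−α)) > 0, and f is strictly increasing and strictly concave on [a,b]. -/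
/-- Any affine piece bounds the upper envelope from below. -/
lemma mul_sub_le_uh {n : ℕ} (hn : 0 < n) (R c : Fin n → ℝ) (γ : ℝ) (j : Fin n) :
    γ * R j - c j ≤ uh n hn R c γ :=
  Finset.le_sup' (fun j => γ * R j - c j) (Finset.mem_univ j)

lemma hasDerivAt_const_sub_div (A B : ℝ) {x : ℝ} (hx : x ≠ 0) :
    HasDerivAt (fun y => A - B / y) (B / x ^ 2) x := by
  have h := ((hasDerivAt_inv hx).const_mul B).const_sub A
  simpa [div_eq_mul_inv] using h

lemma strictMonoOn_const_sub_div (A : ℝ) {B : ℝ} (hB : 0 < B) :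
    StrictMonoOn (fun x : ℝ => A - B / x) (Set.Ioi 0) := fun _ hx _ _ hxy =>
  sub_lt_sub_left (div_lt_div_of_pos_left hB hx hxy) A

lemma strictConcaveOn_const_sub_div (A : ℝ) {B : ℝ} (hB : 0 < B) :
    StrictConcaveOn ℝ (Set.Ioi 0) (fun x : ℝ => A - B / x) := by
  refine ⟨convex_Ioi 0, fun x hx y hy hxy s t hs ht hst => ?_⟩
  have hx0 : 0 < x := hx
  have hy0 : 0 < y := hy
  have hz : 0 < s * x + t * y := by positivity
  have hd : 0 < (x - y) ^ 2 := by
    have := sub_ne_zero.mpr hxy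
    positivity
  obtain rfl : t = 1 - s := by linarith
  simp only [smul_eq_mul]
  have key : A - B / (s * x + (1 - s) * y) - (s * (A - B / x) + (1 - s) * (A - B / y)) =
      B * s * (1 - s) * (x - y) ^ 2 / (x * y * (s * x + (1 - s) * y)) := by
    field_simp
    ring
  have : 0 < B * s * (1 - s) * (x - y) ^ 2 / (x * y * (s * x + (1 - s) * y)) := by positivity
  linarith

/-- on a segment `[a,b] ⊆ (0,1]` where `u_h(γ) = γ R_p - c_p`
and `u_h(δ(γ)) = δ(γ) R_q - c_q`, the function `f(γ) = δ(γ)/(γ(1-α))` is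
differentiable with positive derivative `(c_p - c_q + κ_S)/(R_q γ² (1-α))`,
and it is strictly increasing and strictly concave on `[a,b]`. -/
theorem f_differentiable_increasing_concave
    (n : ℕ) (hn : 0 < n) (R c : Fin n → ℝ)
    (hc0 : 0 ≤ c ⟨0, hn⟩) (hc : StrictMono c)
    (hR0 : 0 < R ⟨0, hn⟩) (hR : StrictMono R)
    (κS : ℝ) (hκS : 0 < κS) (α : ℝ) (hα0 : 0 < α) (hα1 : α < 1)
    (δ : ℝ → ℝ)
    (hδ : ∀ γ ∈ Set.Ioc (0 : ℝ) 1, κS ≤ uh n hn R c γ →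
      δ γ ∈ Set.Icc 0 γ ∧ uh n hn R c (δ γ) = uh n hn R c γ - κS)
    (a b : ℝ) (hab : a < b) (ha : 0 < a) (hb : b ≤ 1)
    (hκ : ∀ γ ∈ Set.Icc a b, κS ≤ uh n hn R c γ)
    (p q : Fin n)
    (hp : ∀ γ ∈ Set.Icc a b, uh n hn R c γ = γ * R p - c p)
    (hq : ∀ γ ∈ Set.Icc a b, uh n hn R c (δ γ) = δ γ * R q - c q) :
    (∀ γ ∈ Set.Ioo a b,
      HasDerivAt (fun x => δ x / (x * (1 - α)))
        ((c p - c q + κS) / (R q * γ ^ 2 * (1 - α))) γ ∧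
      0 < (c p - c q + κS) / (R q * γ ^ 2 * (1 - α))) ∧
    StrictMonoOn (fun x => δ x / (x * (1 - α))) (Set.Icc a b) ∧
    StrictConcaveOn ℝ (Set.Icc a b) (fun x => δ x / (x * (1 - α))) := by
  have hα : 0 < 1 - α := sub_pos.mpr hα1
  have hRpos : ∀ j, 0 < R j := fun j =>
    hR0.trans_le (hR.monotone (Fin.mk_le_of_le_val (Nat.zero_le _)))
  have hRq := hRpos q
  have hpos : ∀ {x}, x ∈ Set.Icc a b → 0 < x := fun hx => ha.trans_le hx.1
  have hspec : ∀ x ∈ Set.Icc a b,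
      δ x ∈ Set.Icc 0 x ∧ uh n hn R c (δ x) = uh n hn R c x - κS := fun x hx =>
    hδ x ⟨hpos hx, hx.2.trans hb⟩ (hκ x hx)
  have hqp : q ≤ p := by
    have haI : a ∈ Set.Icc a b := ⟨le_rfl, hab.le⟩
    obtain ⟨⟨-, hle⟩, heq⟩ := hspec a haI
    have hlt : δ a < a := lt_of_le_of_ne hle fun h => by
      rw [h] at heq
      linarith
    have h1 := mul_sub_le_uh hn R c a q
    have h2 := mul_sub_le_uh hn R c (δ a) p
    rw [hp a haI] at h1
    rw [hq a haI] at h2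
    by_contra! h
    nlinarith [mul_pos (sub_pos.mpr hlt) (sub_pos.mpr (hR h))]
  have hK : 0 < c p - c q + κS := by linarith [hc.monotone hqp]
  set A := R p / (R q * (1 - α)) with hA
  set B := (c p - c q + κS) / (R q * (1 - α)) with hB
  have hBpos : 0 < B := by positivity
  have hEq : Set.EqOn (fun x => A - B / x) (fun x => δ x / (x * (1 - α))) (Set.Icc a b) := by
    intro x hx
    have hx0 := hpos hx
    have hδx : δ x = (x * R p - (c p - c q + κS)) / R q := by
      rw [eq_div_iff hRq.ne']
      linarith [(hspec x hx).2, hp x hx, hq x hx]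
    simp only [hA, hB, hδx]
    field_simp
  have hsub : Set.Icc a b ⊆ Set.Ioi 0 := fun x hx => hpos hx
  refine ⟨fun γ hγ => ?_, ((strictMonoOn_const_sub_div A hBpos).mono hsub).congr hEq,
    ((strictConcaveOn_const_sub_div A hBpos).subset hsub (convex_Icc a b)).congr hEq⟩
  have hγ0 : 0 < γ := ha.trans hγ.1
  refine ⟨?_, by positivity⟩
  have hderiv : (c p - c q + κS) / (R q * γ ^ 2 * (1 - α)) = B / γ ^ 2 := by
    rw [hB]
    field_simp
  rw [hderiv]
  exact (hasDerivAt_const_sub_div A B hγ0.ne').congr_of_eventuallyEq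
    (hEq.symm.eventuallyEq_of_mem (Icc_mem_nhds hγ.1 hγ.2))
end

section
/- Let 0 < κ_I < κ'_I. If γ* ∈ F maximizes U_{κ_I} over F and γ' ∈ F maximizes U_{κ'_I} over F, then β(γ') ≤ β(γ*); moreover, if β(γ*) > 0 then γ' ≥ γ*. In words: when the inspection cost increases, the optimal contract's inspection probability weakly decreases and the optimal payment share weakly increases. -/
theorem exists_eq_uh (n : ℕ) (hn : 0 < n) (R c : Fin n → ℝ) (γ : ℝ) :
    ∃ j, uh n hn R c γ = γ * R j - c j := by
  obtain ⟨j, -, hj⟩ := Finset.exists_mem_eq_sup'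
    (Finset.univ_nonempty_iff.mpr (Fin.pos_iff_nonempty.mp hn)) (fun j => γ * R j - c j)
  exact ⟨j, hj⟩

theorem uh_mono (n : ℕ) (hn : 0 < n) (R c : Fin n → ℝ) (hR : ∀ j, 0 < R j) :
    Monotone (uh n hn R c) := by
  intro x y hxy
  obtain ⟨j, hj⟩ := exists_eq_uh n hn R c x
  have h := le_uh n hn R c y j
  have := mul_le_mul_of_nonneg_right hxy (hR j).le
  linarith

/-- The gap `u_h(x) - u_h(t x)` is strictly increasing in `x` when `t < 1`. -/
theorem uh_sub_uh_mul_lt (n : ℕ) (hn : 0 < n) (R c : Fin n → ℝ) (hR : ∀ j, 0 < R j)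
    {t x y : ℝ} (ht1 : t < 1) (hx : 0 < x) (hxy : x < y) :
    uh n hn R c x - uh n hn R c (t * x) < uh n hn R c y - uh n hn R c (t * y) := by
  obtain ⟨j, hj⟩ := exists_eq_uh n hn R c x
  obtain ⟨k, hk⟩ := exists_eq_uh n hn R c (t * y)
  rcases le_or_gt (R k) (R j) with hkj | hkj
  · have h1 := le_uh n hn R c y j
    have h2 := le_uh n hn R c (t * x) k
    have h3 : t * R k < R j := by nlinarith [hR k]
    have h4 := mul_pos (sub_pos.mpr hxy) (sub_pos.mpr h3)
    linarith
  · have h1 := le_uh n hn R c y k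
    have h2 := le_uh n hn R c (t * x) j
    have h3 : x * R j < y * R k := mul_lt_mul hxy hkj.le (hR j) (hx.trans hxy).le
    have h4 := mul_pos (sub_pos.mpr ht1) (sub_pos.mpr h3)
    linarith

/-- The ratio `δ(x) / x` is strictly increasing. -/
theorem div_lt_div_of_uh_eq (n : ℕ) (hn : 0 < n) (R c : Fin n → ℝ) (hR : ∀ j, 0 < R j)
    {κ x y d e : ℝ} (hκ : 0 < κ) (hx : 0 < x) (hxy : x < y) (hdx : d ≤ x)
    (hd : uh n hn R c d = uh n hn R c x - κ) (he : uh n hn R c e = uh n hn R c y - κ) :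
    d / x < e / y := by
  by_contra! hle
  have hdx' : d < x := hdx.lt_of_ne (by rintro rfl; linarith)
  have hgap := uh_sub_uh_mul_lt n hn R c hR
    ((div_lt_one hx).mpr hdx') hx hxy
  rw [div_mul_cancel₀ d hx.ne'] at hgap
  have := uh_mono n hn R c hR ((div_le_iff₀ (hx.trans hxy)).mp hle)
  linarith

/-- when the inspection cost increases from `κ_I` to `κ'_I`,
the optimal inspection probability weakly decreases, and (when the old optimal
inspection probability is positive) the optimal payment share weakly
increases.  Here `ρ(γ)` is the largest reward among maximizers at `γ`, the
objective is `U_{κ_I}(γ) = (1-γ) ρ(γ) - β(γ) κ_I`, and the feasible set is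
`F = {γ ∈ (0,1] : u_h(γ) ≥ κ_S}`. -/
theorem comparative_statics_inspection_cost
    (n : ℕ) (hn : 0 < n) (R c : Fin n → ℝ)
    (hc0 : 0 ≤ c ⟨0, hn⟩) (hc : StrictMono c)
    (hR0 : 0 < R ⟨0, hn⟩) (hR : StrictMono R)
    (κS : ℝ) (hκS : 0 < κS) (α : ℝ) (hα0 : 0 < α) (hα1 : α < 1)
    (δ : ℝ → ℝ)
    (hδ : ∀ γ ∈ Set.Ioc (0 : ℝ) 1, κS ≤ uh n hn R c γ →
      δ γ ∈ Set.Icc 0 γ ∧ uh n hn R c (δ γ) = uh n hn R c γ - κS)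
    (ρ : ℝ → ℝ)
    (hρ : ∀ γ : ℝ, (∃ i : Fin n, γ * R i - c i = uh n hn R c γ ∧ ρ γ = R i) ∧
      ∀ i : Fin n, γ * R i - c i = uh n hn R c γ → R i ≤ ρ γ)
    (κI κI' : ℝ) (hκI : 0 < κI) (hκI' : κI < κI')
    (γstar γ' : ℝ)
    (hγstarF : γstar ∈ Set.Ioc (0 : ℝ) 1 ∧ κS ≤ uh n hn R c γstar)
    (hγstarOpt : ∀ γ ∈ Set.Ioc (0 : ℝ) 1, κS ≤ uh n hn R c γ →
      (1 - γ) * ρ γ - betaFn α δ γ * κI ≤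
        (1 - γstar) * ρ γstar - betaFn α δ γstar * κI)
    (hγ'F : γ' ∈ Set.Ioc (0 : ℝ) 1 ∧ κS ≤ uh n hn R c γ')
    (hγ'Opt : ∀ γ ∈ Set.Ioc (0 : ℝ) 1, κS ≤ uh n hn R c γ →
      (1 - γ) * ρ γ - betaFn α δ γ * κI' ≤
        (1 - γ') * ρ γ' - betaFn α δ γ' * κI') :
    betaFn α δ γ' ≤ betaFn α δ γstar ∧
    (0 < betaFn α δ γstar → γstar ≤ γ') := by
  have hRpos : ∀ j, 0 < R j := fun j => hR0.trans_le (hR.monotone (Nat.zero_le j.val))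
  have hβ : betaFn α δ γ' ≤ betaFn α δ γstar := by
    have h1 := hγstarOpt γ' hγ'F.1 hγ'F.2
    have h2 := hγ'Opt γstar hγstarF.1 hγstarF.2
    nlinarith
  refine ⟨hβ, fun hpos => ?_⟩
  by_contra! hlt
  obtain ⟨hδ', hu'⟩ := hδ γ' hγ'F.1 hγ'F.2
  obtain ⟨-, hu⟩ := hδ γstar hγstarF.1 hγstarF.2
  have hratio := div_lt_div_of_uh_eq n hn R c hRpos hκS hγ'F.1.1 hlt hδ'.2 hu' hu
  have hdiv := div_lt_div_of_pos_right hratio (sub_pos.mpr hα1)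
  rw [div_div, div_div] at hdiv
  have hlarge : 1 - δ γ' / (γ' * (1 - α)) ≤ betaFn α δ γ' := le_max_left _ _
  have hstar : betaFn α δ γstar = 1 - δ γstar / (γstar * (1 - α)) := by
    refine max_eq_left (le_of_lt ?_)
    exact (lt_max_iff.mp hpos).resolve_right (lt_irrefl 0)
  linarith
end

section
/- Let 0 < κ < κ'. Then the function γ ↦ β_{κ'}(γ) − β_κ(γ) is weakly decreasing on the set D := {γ ∈ (0,1] : u_h(γ) − κ' ≥ u_h(0)}. -/
/-- Increments of a convex function over intervals of equal length grow to the right. -/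
theorem ConvexOn.add_sub_le_add_sub {f : ℝ → ℝ} (hf : ConvexOn ℝ Set.univ f) {p r h : ℝ}
    (hpr : p ≤ r) (hh : 0 ≤ h) : f (p + h) - f p ≤ f (r + h) - f r := by
  rcases (add_nonneg (sub_nonneg.mpr hpr) hh).eq_or_lt with h0 | h0
  · obtain rfl : p = r := by linarith
    exact le_rfl
  have hsum : (r - p) / (r - p + h) + h / (r - p + h) = 1 := by field_simp
  have hsum' : h / (r - p + h) + (r - p) / (r - p + h) = 1 := by field_simp; ring
  have h1 := hf.2 (Set.mem_univ p) (Set.mem_univ (r + h))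
    (div_nonneg (sub_nonneg.mpr hpr) h0.le) (div_nonneg hh h0.le) hsum
  have h2 := hf.2 (Set.mem_univ p) (Set.mem_univ (r + h))
    (div_nonneg hh h0.le) (div_nonneg (sub_nonneg.mpr hpr) h0.le) hsum'
  have e1 : (r - p) / (r - p + h) * p + h / (r - p + h) * (r + h) = p + h := by
    field_simp; ring
  have e2 : h / (r - p + h) * p + (r - p) / (r - p + h) * (r + h) = r := by
    field_simp; ring
  simp only [smul_eq_mul, e1, e2] at h1 h2
  linear_combination h1 + h2 + (f p + f (r + h)) * hsum

/-- For an increasing convex function, equal increments need shorter intervals to the right. -/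
theorem ConvexOn.sub_le_sub_of_sub_eq_sub {f : ℝ → ℝ} (hf : ConvexOn ℝ Set.univ f)
    (hm : StrictMono f) {p q r s : ℝ} (hpr : p ≤ r) (hpq : p ≤ q)
    (h : f q - f p = f s - f r) : s - r ≤ q - p := by
  have h1 := hf.add_sub_le_add_sub hpr (sub_nonneg.mpr hpq)
  rw [add_sub_cancel] at h1
  have := hm.le_iff_le.mp (show f s ≤ f (r + (q - p)) by linarith)
  linarith

theorem div_le_div_of_sub_le_sub {x y p r : ℝ} (hx : 0 < x) (hxy : x ≤ y) (hpx : p ≤ x)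
    (h : y - x ≤ r - p) : p / x ≤ r / y := by
  rw [div_le_div_iff₀ hx (hx.trans_le hxy)]
  nlinarith [mul_nonneg (sub_nonneg.mpr hxy) (sub_nonneg.mpr hpx),
    mul_le_mul_of_nonneg_left h hx.le]

theorem max_sub_max_le_max_sub_max {P Q R S : ℝ} (hPQ : P ≤ Q) (hPR : P ≤ R)
    (hQS : Q ≤ S) (h : S - R ≤ Q - P) :
    max (1 - R) 0 - max (1 - S) 0 ≤ max (1 - P) 0 - max (1 - Q) 0 := by
  rcases max_cases (1 - R) 0 with h1 | h1 <;> rcases max_cases (1 - S) 0 with h2 | h2 <;>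
  rcases max_cases (1 - P) 0 with h3 | h3 <;> rcases max_cases (1 - Q) 0 with h4 | h4 <;>
  linarith

/-- for safety costs `0 < κ < κ'`, the difference
`β_{κ'}(γ) - β_κ(γ)` is weakly decreasing on
`D = {γ ∈ (0,1] : u_h(γ) - κ' ≥ u_h(0)}`.  Here `δ_κ(γ) ≥ 0` is the unique
value with `u_h(δ_κ(γ)) = u_h(γ) - κ`. -/
theorem betaFn_difference_antitone
    (n : ℕ) (hn : 0 < n) (R c : Fin n → ℝ)
    (hc0 : 0 ≤ c ⟨0, hn⟩) (hc : StrictMono c)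
    (hR0 : 0 < R ⟨0, hn⟩) (hR : StrictMono R)
    (α : ℝ) (hα0 : 0 < α) (hα1 : α < 1)
    (κ κ' : ℝ) (hκ0 : 0 < κ) (hκκ' : κ < κ')
    (δ : ℝ → ℝ → ℝ)
    (hδ : ∀ k : ℝ, 0 < k → ∀ γ ∈ Set.Ioc (0 : ℝ) 1,
      uh n hn R c 0 ≤ uh n hn R c γ - k →
      0 ≤ δ k γ ∧ uh n hn R c (δ k γ) = uh n hn R c γ - k) :
    AntitoneOn (fun γ => betaFn α (δ κ') γ - betaFn α (δ κ) γ)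
      {γ : ℝ | γ ∈ Set.Ioc (0 : ℝ) 1 ∧ uh n hn R c 0 ≤ uh n hn R c γ - κ'} := by
  rintro x ⟨hx, hxD⟩ y ⟨hy, hyD⟩ hxy
  have hm : StrictMono (uh n hn R c) := uh_strictMono n hn R c fun j =>
    hR0.trans_le (hR.monotone (Fin.mk_le_of_le_val (Nat.zero_le _)))
  have hf := uh_convexOn n hn R c
  have hκ'0 := hκ0.trans hκκ'
  obtain ⟨-, hp⟩ := hδ κ' hκ'0 x hx hxD
  obtain ⟨-, hq⟩ := hδ κ hκ0 x hx (by linarith)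
  obtain ⟨-, hr⟩ := hδ κ' hκ'0 y hy hyD
  obtain ⟨-, hs⟩ := hδ κ hκ0 y hy (by linarith)
  have huxy := hm.monotone hxy
  have hpq : δ κ' x ≤ δ κ x := hm.le_iff_le.mp (by linarith)
  have hrs : δ κ' y ≤ δ κ y := hm.le_iff_le.mp (by linarith)
  have hpr : δ κ' x ≤ δ κ' y := hm.le_iff_le.mp (by linarith)
  have hqs : δ κ x ≤ δ κ y := hm.le_iff_le.mp (by linarith)
  have hpx : δ κ' x ≤ x := hm.le_iff_le.mp (by linarith)
  have hqx : δ κ x ≤ x := hm.le_iff_le.mp (by linarith)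
  have ha : 0 ≤ 1 - α := by linarith
  have hκ'div := div_le_div_of_sub_le_sub hx.1 hxy hpx
    (hf.sub_le_sub_of_sub_eq_sub hm hpx hpr (by linarith))
  have hκdiv := div_le_div_of_sub_le_sub hx.1 hxy hqx
    (hf.sub_le_sub_of_sub_eq_sub hm hqx hqs (by linarith))
  have hgap : δ κ y - δ κ' y ≤ δ κ x - δ κ' x :=
    hf.sub_le_sub_of_sub_eq_sub hm hpr hpq (by linarith)
  have hgapdiv : (δ κ y - δ κ' y) / y ≤ (δ κ x - δ κ' x) / x :=
    div_le_div₀ (sub_nonneg.mpr hpq) hgap hx.1 hxy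
  simp only [betaFn, ← div_div]
  refine max_sub_max_le_max_sub_max ?_ ?_ ?_ ?_
  · exact div_le_div_of_nonneg_right (div_le_div_of_nonneg_right hpq hx.1.le) ha
  · exact div_le_div_of_nonneg_right hκ'div ha
  · exact div_le_div_of_nonneg_right hκdiv ha
  · simp only [← sub_div]
    exact div_le_div_of_nonneg_right hgapdiv ha
end

section
/- There exists a finitely supported probability distribution μ over subsets S ⊆ {1,…,m} with |S| ≤ B such that, for every agent ℓ ∈ {1,…,m}, the probability that ℓ ∈ S equals β̄^ℓ, i.e., ∑_{S : ℓ ∈ S} μ(S) = β̄^ℓ. (This captures the random assignment of B inspectors to m agents in which each agent is inspected by at most one inspector and agent ℓ is inspected with probability exactly β̄^ℓ.) -/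
/-- The inspection vectors in `[0,1]^ι` whose coordinates sum to at most `B`. -/
def cappedCube (ι : Type*) [Fintype ι] (B : ℕ) : Set (ι → ℝ) :=
  {x | (∀ i, 0 ≤ x i ∧ x i ≤ 1) ∧ ∑ i, x i ≤ (B : ℝ)}

/-- The vectors of inclusion probabilities of random subsets with at most `B` elements. -/
def inclusionVectors (ι : Type*) [Fintype ι] [DecidableEq ι] (B : ℕ) : Set (ι → ℝ) :=
  {x | ∃ μ : Finset ι → ℝ, (∀ S, 0 ≤ μ S) ∧ (∑ S : Finset ι, μ S) = 1 ∧
    (∀ S, μ S ≠ 0 → S.card ≤ B) ∧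
    ∀ i, (∑ S ∈ Finset.univ.filter (fun S : Finset ι => i ∈ S), μ S) = x i}

section

variable {ι : Type*} [Fintype ι] {B : ℕ}

theorem convex_cappedCube : Convex ℝ (cappedCube ι B) := by
  rintro x ⟨hx, hxs⟩ y ⟨hy, hys⟩ a b ha hb hab
  refine ⟨fun i => ?_, ?_⟩
  · obtain ⟨h1, h2⟩ := hx i
    obtain ⟨h3, h4⟩ := hy i
    simp only [Pi.add_apply, Pi.smul_apply, smul_eq_mul]
    constructor
    · positivity
    · nlinarith
  · simp only [Pi.add_apply, Pi.smul_apply, smul_eq_mul, Finset.sum_add_distrib, ← Finset.mul_sum]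
    calc _ ≤ a * (B : ℝ) + b * B := by gcongr
      _ = B := by rw [← add_mul, hab, one_mul]

theorem isCompact_cappedCube : IsCompact (cappedCube ι B) := by
  have h : cappedCube ι B = Set.Icc (0 : ι → ℝ) 1 ∩ {x | ∑ i, x i ≤ (B : ℝ)} := by
    ext x
    simp [cappedCube, Pi.le_def, forall_and]
  rw [h]
  exact isCompact_Icc.inter_right (isClosed_le (by fun_prop) continuous_const)

theorem eq_zero_of_add_mem_of_sub_mem_of_mem_extremePoints {E : Type*} [AddCommGroup E]
    [Module ℝ E] {A : Set E} {x v : E} (hx : x ∈ A.extremePoints ℝ) (hadd : x + v ∈ A)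
    (hsub : x - v ∈ A) : v = 0 := by
  have h := (mem_extremePoints.1 hx).2 (x + v) hadd (x - v) hsub
    ⟨1 / 2, 1 / 2, by norm_num, by norm_num, by norm_num, by module⟩
  simpa using h.1

variable [DecidableEq ι]

theorem exists_indicator_of_mem_extremePoints_cappedCube {x : ι → ℝ}
    (hx : x ∈ (cappedCube ι B).extremePoints ℝ) :
    ∃ S : Finset ι, S.card ≤ B ∧ x = fun i => if i ∈ S then 1 else 0 := by
  obtain ⟨hbd, hsum⟩ := hx.1
  have hint : ∀ i, x i = 0 ∨ x i = 1 := by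
    by_contra! ⟨i, hi0, hi1⟩
    have hi0' : 0 < x i := lt_of_le_of_ne (hbd i).1 hi0.symm
    have hi1' : x i < 1 := lt_of_le_of_ne (hbd i).2 hi1
    by_cases hj : ∃ j, j ≠ i ∧ x j ≠ 0 ∧ x j ≠ 1
    · obtain ⟨j, hji, hj0, hj1⟩ := hj
      have hj0' : 0 < x j := lt_of_le_of_ne (hbd j).1 hj0.symm
      have hj1' : x j < 1 := lt_of_le_of_ne (hbd j).2 hj1
      obtain ⟨ε, hε, hεle⟩ : ∃ ε > 0, ε ≤ x i ∧ ε ≤ 1 - x i ∧ ε ≤ x j ∧ ε ≤ 1 - x j :=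
        ⟨min (min (x i) (1 - x i)) (min (x j) (1 - x j)), by simp [*], by simp⟩
      obtain ⟨h1, h2, h3, h4⟩ := hεle
      have hv := eq_zero_of_add_mem_of_sub_mem_of_mem_extremePoints
        (v := Pi.single i ε - Pi.single j ε) hx
        ⟨fun k => ?_, by simpa [Finset.sum_add_distrib] using hsum⟩
        ⟨fun k => ?_, by simpa [Finset.sum_sub_distrib] using hsum⟩
      · have := congrFun hv i
        simp [hji.symm] at this
        exact hε.ne' this
      all_goals
        have := hbd k
        simp only [Pi.add_apply, Pi.sub_apply, Pi.single_apply]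
        split_ifs <;> subst_vars <;> constructor <;> first | contradiction | linarith
    · push Not at hj
      obtain ⟨n, hn⟩ : ∃ n : ℕ, ∑ k ∈ Finset.univ.erase i, x k = n := by
        refine ⟨∑ k ∈ Finset.univ.erase i, if x k = 0 then 0 else 1, ?_⟩
        push_cast
        refine Finset.sum_congr rfl fun k hk => ?_
        split_ifs with h
        · exact h
        · exact hj k (Finset.ne_of_mem_erase hk) h
      have hs : ∑ k, x k = n + x i := by
        rw [← hn, Finset.sum_erase_add _ _ (Finset.mem_univ i)]
      have hnB : (n : ℝ) + 1 ≤ B := by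
        have : (n : ℝ) < B := by linarith
        exact_mod_cast this
      obtain ⟨ε, hε, h1, h2⟩ : ∃ ε > 0, ε ≤ x i ∧ ε ≤ 1 - x i :=
        ⟨min (x i) (1 - x i), by simp [*], by simp⟩
      have hv := eq_zero_of_add_mem_of_sub_mem_of_mem_extremePoints (v := Pi.single i ε) hx
        ⟨fun k => ?_, by simp [Finset.sum_add_distrib]; linarith⟩
        ⟨fun k => ?_, by simp [Finset.sum_sub_distrib]; linarith⟩
      · have := congrFun hv i
        simp at this
        exact hε.ne' this
      all_goals
        have := hbd k
        simp only [Pi.add_apply, Pi.sub_apply, Pi.single_apply]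
        split_ifs <;> subst_vars <;> constructor <;> linarith
  have hxS : x = fun i => if i ∈ Finset.univ.filter (fun i => x i = 1) then 1 else 0 := by
    funext i
    rcases hint i with h | h <;> simp [h]
  refine ⟨_, ?_, hxS⟩
  rw [hxS] at hsum
  simpa using hsum

theorem indicator_mem_inclusionVectors {S : Finset ι} (hS : S.card ≤ B) :
    (fun i => if i ∈ S then 1 else 0) ∈ inclusionVectors ι B := by
  refine ⟨Pi.single S 1, fun T => ?_, by simp, fun T hT => ?_, fun i => ?_⟩
  · by_cases h : T = S <;> simp [h]
  · by_cases h : T = S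
    · exact h ▸ hS
    · simp [h] at hT
  · simp

theorem convex_inclusionVectors : Convex ℝ (inclusionVectors ι B) := by
  rintro x ⟨μ, hμ0, hμ1, hμB, hμ⟩ y ⟨ν, hν0, hν1, hνB, hν⟩ a b ha hb hab
  refine ⟨a • μ + b • ν, fun S => ?_, ?_, fun S hS => ?_, fun i => ?_⟩
  · have := hμ0 S
    have := hν0 S
    simp only [Pi.add_apply, Pi.smul_apply, smul_eq_mul]
    positivity
  · simp [Finset.sum_add_distrib, ← Finset.mul_sum, hμ1, hν1, hab]
  · by_contra h
    have h1 : μ S = 0 := by_contra fun h' => h (hμB S h')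
    have h2 : ν S = 0 := by_contra fun h' => h (hνB S h')
    simp [h1, h2] at hS
  · simp only [Pi.add_apply, Pi.smul_apply, smul_eq_mul, Finset.sum_add_distrib,
      ← Finset.mul_sum, hμ, hν]

theorem cappedCube_subset_inclusionVectors : cappedCube ι B ⊆ inclusionVectors ι B := by
  have hext : (cappedCube ι B).extremePoints ℝ ⊆
      Set.range fun (S : Finset ι) (i : ι) => if i ∈ S then (1 : ℝ) else 0 := fun x hx => by
    obtain ⟨S, -, rfl⟩ := exists_indicator_of_mem_extremePoints_cappedCube hx
    exact ⟨S, rfl⟩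
  have hfin := (Set.finite_range _).subset hext
  rw [← closure_convexHull_extremePoints isCompact_cappedCube convex_cappedCube,
    (hfin.isClosed_convexHull ℝ).closure_eq]
  refine convexHull_min (fun x hx => ?_) convex_inclusionVectors
  obtain ⟨S, hS, rfl⟩ := exists_indicator_of_mem_extremePoints_cappedCube hx
  exact indicator_mem_inclusionVectors hS

end


/-- given target inspection probabilities `β̄ ∈ [0,1]^m` with
`∑ β̄^ℓ ≤ B`, there is a finitely supported probability distribution `μ` over
subsets `S ⊆ {1,…,m}` with `|S| ≤ B` (the set of inspected agents) such that
each agent `ℓ` is inspected with probability exactly `β̄^ℓ`. -/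
theorem random_inspection_assignment
    (m B : ℕ) (βbar : Fin m → ℝ)
    (h0 : ∀ ℓ, 0 ≤ βbar ℓ) (h1 : ∀ ℓ, βbar ℓ ≤ 1)
    (hsum : ∑ ℓ, βbar ℓ ≤ (B : ℝ)) :
    ∃ μ : Finset (Fin m) → ℝ,
      (∀ S, 0 ≤ μ S) ∧
      (∑ S : Finset (Fin m), μ S) = 1 ∧
      (∀ S, μ S ≠ 0 → S.card ≤ B) ∧
      ∀ ℓ : Fin m,
        (∑ S ∈ Finset.univ.filter (fun S : Finset (Fin m) => ℓ ∈ S), μ S)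
          = βbar ℓ := by
  exact cappedCube_subset_inclusionVectors ⟨fun ℓ => ⟨h0 ℓ, h1 ℓ⟩, hsum⟩
end
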